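/- Let q be a piecewise constant function on a bounded domain Ω ⊂ R^3, q = Σ_{j=1}^N q_j χ_{T_j}, where {T_j} is a partition of Ω into N sets each of finite perimeter, with |q_j| ≤ Q_0, |T_j| ≤ V_0, and |∂T_j| ≤ S_0. Then for every s ∈ (0, 1/2), ‖q‖²_{H^s(Ω)} ≤ 2 Q_0² N V_0^{1−2s} S_0^{2s}, i.e., the squared fractional Sobolev norm of q grows at most linearly in N. -/

import Mathlib

open Metric Set MeasureTheory FourierTransform
open scoped ENNReal ContDiff

section

variable {V : Type*} [NormedAddCommGroup V] [InnerProductSpace ℝ V] [FiniteDimensional ℝ V]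
  [MeasurableSpace V] [BorelSpace V]

/-- The `L²` Fourier transform agrees almost everywhere with the Fourier integral on `L¹ ∩ L²`. -/
theorem coeFn_fourier_toLp_two_ae_eq {f : V → ℂ} (hf : Integrable f) (hf2 : MemLp f 2) :
    ⇑(𝓕 (hf2.toLp f) : Lp ℂ 2 (volume : Measure V)) =ᵐ[volume] 𝓕 f := by
  have hcont : Continuous (𝓕 f) :=
    VectorFourier.fourierIntegral_continuous Real.continuous_fourierChar continuous_inner hf
  have hloc : LocallyIntegrable (fun x => (𝓕 (hf2.toLp f) : Lp ℂ 2 (volume : Measure V)) x) :=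
    (Lp.memLp _).locallyIntegrable (by norm_num)
  have key := ae_eq_zero_of_integral_contDiff_smul_eq_zero (μ := volume)
    (f := fun x => (𝓕 (hf2.toLp f) : Lp ℂ 2 (volume : Measure V)) x - 𝓕 f x)
    (hloc.sub hcont.locallyIntegrable) ?_
  · filter_upwards [key] with x hx using sub_eq_zero.1 hx
  intro g hg hgs
  have hgs' : HasCompactSupport (fun x => (g x : ℂ)) := hgs.comp_left Complex.ofReal_zero
  have hg' : ContDiff ℝ ∞ (fun x => (g x : ℂ)) := Complex.ofRealCLM.contDiff.comp hg
  set G : SchwartzMap V ℂ := hgs'.toSchwartzMap hg' with hG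
  have hGa : ∀ x, G x = g x := fun x => by simp [hG]
  have h1 : ∫ x, G x • (𝓕 (hf2.toLp f) : Lp ℂ 2 (volume : Measure V)) x = ∫ x, 𝓕 G x • f x := by
    rw [← Lp.toTemperedDistribution_apply, ← Lp.fourier_toTemperedDistribution_eq,
      TemperedDistribution.fourier_apply, Lp.toTemperedDistribution_apply]
    refine integral_congr_ae ?_
    filter_upwards [hf2.coeFn_toLp] with x hx
    rw [hx]
  have h2 : ∫ x, 𝓕 G x • f x = ∫ x, G x • 𝓕 f x := by
    rw [SchwartzMap.fourier_coe]
    simpa using! VectorFourier.integral_fourierIntegral_smul_eq_flip (L := innerₗ V)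
      Real.continuous_fourierChar continuous_inner G.integrable hf
  have i1 := hloc.integrable_smul_left_of_hasCompactSupport hg.continuous hgs
  have i2 := hcont.locallyIntegrable (μ := volume) |>.integrable_smul_left_of_hasCompactSupport
    hg.continuous hgs
  simp only [smul_sub]
  rw [integral_sub i1 i2, sub_eq_zero]
  simpa [hGa] using h1.trans h2

/-- Plancherel's theorem for the Fourier integral of a function in `L¹ ∩ L²`. -/
theorem lintegral_enorm_fourier_sq {f : V → ℂ} (hf : Integrable f) (hf2 : MemLp f 2) :
    ∫⁻ ξ, ‖𝓕 f ξ‖ₑ ^ 2 = ∫⁻ x, ‖f x‖ₑ ^ 2 := by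
  have h : eLpNorm (𝓕 f) 2 volume = eLpNorm f 2 volume := by
    rw [← eLpNorm_congr_ae (coeFn_fourier_toLp_two_ae_eq hf hf2),
      ← eLpNorm_congr_ae hf2.coeFn_toLp, ← Lp.enorm_def, ← Lp.enorm_def,
      ← ofReal_norm, ← ofReal_norm, Lp.norm_fourier_eq]
  have e : ∀ g : V → ℂ, ∫⁻ x, ‖g x‖ₑ ^ 2 = eLpNorm g 2 volume ^ 2 := fun g => by
    simpa using (eLpNorm_nnreal_pow_eq_lintegral (μ := volume) (f := g) (p := 2) two_ne_zero).symm
  rw [e, e, h]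

theorem fourier_comp_add_right_sub {f : V → ℂ} (hf : Integrable f) (h ξ : V) :
    𝓕 (fun x => f (x + h) - f x) ξ = ((Real.fourierChar (inner ℝ h ξ) : ℂ) - 1) * 𝓕 f ξ := by
  have h1 : 𝓕 (fun x => f (x + h)) ξ = (Real.fourierChar (inner ℝ h ξ) : ℂ) * 𝓕 f ξ :=
    congrFun (VectorFourier.fourierIntegral_comp_add_right Real.fourierChar volume
      (innerₗ V) f h) ξ
  have h2 : 𝓕 (fun x => f (x + h) - f x) ξ = 𝓕 (fun x => f (x + h)) ξ - 𝓕 f ξ := by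
    simp only [Real.fourier_eq, smul_sub]
    exact integral_sub ((Real.fourierIntegral_convergent_iff ξ).2 (hf.comp_add_right h))
      ((Real.fourierIntegral_convergent_iff ξ).2 hf)
  rw [h2, h1]; ring

theorem lintegral_enorm_fourierChar_sub_one_mul_fourier_sq {f : V → ℂ} (hf : Integrable f)
    (hf2 : MemLp f 2) (h : V) :
    ∫⁻ ξ, ‖(Real.fourierChar (inner ℝ h ξ) : ℂ) - 1‖ₑ ^ 2 * ‖𝓕 f ξ‖ₑ ^ 2 =
      ∫⁻ x, ‖f (x + h) - f x‖ₑ ^ 2 := by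
  have := lintegral_enorm_fourier_sq (f := fun x => f (x + h) - f x) ((hf.comp_add_right h).sub hf)
    ((hf2.comp_measurePreserving (measurePreserving_add_right volume h)).sub hf2)
  simpa only [fourier_comp_add_right_sub hf, enorm_mul, mul_pow] using this

theorem lintegral_stdGaussian_enorm_fourierChar_sub_one_sq (ξ : V) :
    ∫⁻ h, ‖(Real.fourierChar (inner ℝ h ξ) : ℂ) - 1‖ₑ ^ 2 ∂(ProbabilityTheory.stdGaussian V) =
      ENNReal.ofReal (2 - 2 * Real.exp (-(2 * Real.pi ^ 2 * ‖ξ‖ ^ 2))) := by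
  have hpt : ∀ h : V, ‖(Real.fourierChar (inner ℝ h ξ) : ℂ) - 1‖ ^ 2 =
      2 - 2 * (Complex.exp (inner ℝ h ((2 * Real.pi) • ξ) * Complex.I)).re := fun h => by
    rw [Real.fourierChar_apply, inner_smul_right, Complex.sq_norm, Complex.normSq_apply]
    simp only [Complex.sub_re, Complex.sub_im, Complex.exp_ofReal_mul_I_re,
      Complex.exp_ofReal_mul_I_im, Complex.one_re, Complex.one_im]
    nlinarith [Real.sin_sq_add_cos_sq (2 * Real.pi * inner ℝ h ξ)]
  have hint : Integrable (fun h : V => Complex.exp (inner ℝ h ((2 * Real.pi) • ξ) * Complex.I))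
      (ProbabilityTheory.stdGaussian V) :=
    (integrable_const (1 : ℝ)).mono (by fun_prop) (by simp [Complex.norm_exp_ofReal_mul_I])
  have hre : ∫ h, (Complex.exp (inner ℝ h ((2 * Real.pi) • ξ) * Complex.I)).re
      ∂(ProbabilityTheory.stdGaussian V) = Real.exp (-(2 * Real.pi ^ 2 * ‖ξ‖ ^ 2)) := by
    have := ProbabilityTheory.charFun_stdGaussian ((2 * Real.pi) • ξ)
    rw [charFun_apply] at this
    rw [show (fun h : V => (Complex.exp (inner ℝ h ((2 * Real.pi) • ξ) * Complex.I)).re) =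
      fun h => RCLike.re (Complex.exp (inner ℝ h ((2 * Real.pi) • ξ) * Complex.I)) from rfl,
      integral_re hint, this]
    have e : (-(‖(2 * Real.pi) • ξ‖ : ℂ) ^ 2 / 2) = ((-(2 * Real.pi ^ 2 * ‖ξ‖ ^ 2) : ℝ) : ℂ) := by
      rw [norm_smul, Real.norm_of_nonneg (by positivity)]
      push_cast; ring
    rw [e, ← Complex.ofReal_exp]
    exact Complex.ofReal_re _
  have hint' : Integrable (fun h : V =>
      (Complex.exp (inner ℝ h ((2 * Real.pi) • ξ) * Complex.I)).re)
      (ProbabilityTheory.stdGaussian V) := hint.re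
  calc _ = ∫⁻ h, ENNReal.ofReal
        (2 - 2 * (Complex.exp (inner ℝ h ((2 * Real.pi) • ξ) * Complex.I)).re)
        ∂(ProbabilityTheory.stdGaussian V) := by
        refine lintegral_congr fun h => ?_
        rw [← hpt, ENNReal.ofReal_pow (norm_nonneg _), ofReal_norm]
    _ = _ := by
        rw [← ofReal_integral_eq_lintegral_ofReal]
        · rw [integral_sub (integrable_const _) (hint'.const_mul 2), integral_const_mul, hre]
          simp
        · exact (integrable_const _).sub (hint'.const_mul 2)
        · exact Filter.Eventually.of_forall fun h => by
            simp only [Pi.zero_apply, ← hpt]; positivity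

end

theorem integrableOn_Ioi_one_sub_exp_mul_rpow {a α : ℝ} (ha : 0 < a) (h0 : 0 < α) (h2 : α < 2) :
    IntegrableOn (fun t : ℝ => (2 - 2 * Real.exp (-(a * t ^ 2))) * t ^ (-1 - α)) (Ioi 0) := by
  have hmeas : Measurable (fun t : ℝ => (2 - 2 * Real.exp (-(a * t ^ 2))) * t ^ (-1 - α)) := by
    fun_prop
  have hnn : ∀ t : ℝ, 0 ≤ 2 - 2 * Real.exp (-(a * t ^ 2)) := fun t => by
    have : Real.exp (-(a * t ^ 2)) ≤ 1 := Real.exp_le_one_iff.2 (by nlinarith [sq_nonneg t])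
    linarith
  rw [← Ioc_union_Ioi_eq_Ioi (zero_le_one' ℝ)]
  refine IntegrableOn.union ?_ ?_
  · have : IntegrableOn (fun t : ℝ => 2 * a * t ^ (1 - α)) (Ioc 0 1) := by
      have := intervalIntegral.intervalIntegrable_rpow' (a := 0) (b := 1) (r := 1 - α) (by linarith)
      rw [intervalIntegrable_iff_integrableOn_Ioc_of_le zero_le_one] at this
      exact this.const_mul _
    refine this.mono' hmeas.aestronglyMeasurable
      ((ae_restrict_iff' measurableSet_Ioc).2 (Filter.Eventually.of_forall fun t ht => ?_))
    have ht0 : 0 < t := ht.1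
    rw [Real.norm_of_nonneg (mul_nonneg (hnn t) (by positivity))]
    have e : t ^ (1 - α) = t ^ 2 * t ^ (-1 - α) := by
      rw [← Real.rpow_natCast, ← Real.rpow_add ht0]; congr 1; push_cast; ring
    rw [e, ← mul_assoc]
    refine mul_le_mul_of_nonneg_right ?_ (by positivity)
    have := Real.add_one_le_exp (-(a * t ^ 2))
    linarith
  · have : IntegrableOn (fun t : ℝ => 2 * t ^ (-1 - α)) (Ioi 1) :=
      (integrableOn_Ioi_rpow_of_lt (by linarith) one_pos).const_mul _
    refine this.mono' hmeas.aestronglyMeasurable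
      ((ae_restrict_iff' measurableSet_Ioi).2 (Filter.Eventually.of_forall fun t ht => ?_))
    have ht0 : 0 < t := one_pos.trans ht
    rw [Real.norm_of_nonneg (mul_nonneg (hnn t) (by positivity))]
    refine mul_le_mul_of_nonneg_right ?_ (by positivity)
    have := Real.exp_pos (-(a * t ^ 2))
    linarith

theorem exists_lintegral_one_sub_exp_mul_rpow_eq {a α : ℝ} (ha : 0 < a) (h0 : 0 < α) (h2 : α < 2) :
    ∃ C : ℝ, 0 < C ∧ ∀ r : ℝ, 0 ≤ r →
      ∫⁻ t in Ioi (0 : ℝ), ENNReal.ofReal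
        (t ^ (-1 - α)) * ENNReal.ofReal (2 - 2 * Real.exp (-(a * (t * r) ^ 2))) =
      ENNReal.ofReal C * ENNReal.ofReal (r ^ α) := by
  set g : ℝ → ℝ := fun t => (2 - 2 * Real.exp (-(a * t ^ 2))) * t ^ (-1 - α) with hg
  have hpos : ∀ t, 0 < t → 0 < g t := fun t ht => by
    have : Real.exp (-(a * t ^ 2)) < 1 := by
      rw [Real.exp_lt_one_iff]; simp; positivity
    exact mul_pos (by linarith) (by positivity)
  have hint : IntegrableOn g (Ioi 0) := integrableOn_Ioi_one_sub_exp_mul_rpow ha h0 h2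
  refine ⟨∫ t in Ioi 0, g t, ?_, fun r hr => ?_⟩
  · rw [setIntegral_pos_iff_support_of_nonneg_ae
      ((ae_restrict_iff' measurableSet_Ioi).2 (.of_forall fun t ht => (hpos t ht).le)) hint]
    have hsub : Ioi (0 : ℝ) ⊆ Function.support g := fun t ht => (hpos t ht).ne'
    simp [inter_eq_right.2 hsub]
  rcases hr.eq_or_lt with rfl | hr
  · simp [Real.zero_rpow h0.ne']
  have hscale : ∀ t ∈ Ioi (0 : ℝ), ENNReal.ofReal (t ^ (-1 - α)) *
      ENNReal.ofReal (2 - 2 * Real.exp (-(a * (t * r) ^ 2))) =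
      ENNReal.ofReal (r ^ (1 + α) * g (r * t)) := fun t ht => by
    have ht : 0 < t := ht
    rw [← ENNReal.ofReal_mul (by positivity)]
    congr 1
    have e : r ^ (1 + α) * r ^ (-1 - α) = 1 := by
      rw [← Real.rpow_add hr]; ring_nf; simp
    simp only [hg, Real.mul_rpow hr.le ht.le]
    rw [mul_comm t r]
    linear_combination (-(t ^ (-1 - α)) * (2 - 2 * Real.exp (-(a * (r * t) ^ 2)))) * e
  rw [setLIntegral_congr_fun measurableSet_Ioi hscale, ← ofReal_integral_eq_lintegral_ofReal]
  · rw [integral_const_mul, integral_comp_mul_left_Ioi g 0 hr, mul_zero,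
      ← ENNReal.ofReal_mul' (by positivity)]
    congr 1
    rw [Real.rpow_add hr, smul_eq_mul, Real.rpow_one]
    field_simp
  · have := (integrableOn_Ioi_comp_mul_left_iff g 0 hr).2 (by simpa using hint)
    exact this.const_mul _
  · refine (ae_restrict_iff' measurableSet_Ioi).2 (.of_forall fun t ht => ?_)
    exact mul_nonneg (by positivity) (hpos _ (mul_pos hr ht)).le

theorem norm_sum_indicator_sub_sq_le {X ι : Type*} [Fintype ι] {T : ι → Set X}
    (hT : Pairwise (Function.onFun Disjoint T)) (q : ι → ℝ) (x y : X) :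
    ‖(∑ j, (T j).indicator (fun _ => (q j : ℂ)) x) - ∑ j, (T j).indicator (fun _ => (q j : ℂ)) y‖ ^ 2
      ≤ ∑ j, 2 * q j ^ 2 *
        ‖(T j).indicator (fun _ => (1 : ℂ)) x - (T j).indicator (fun _ => (1 : ℂ)) y‖ ^ 2 := by
  classical
  have hq : ∀ (j : ι) (z : X), (T j).indicator (fun _ => (q j : ℂ)) z =
      ((T j).indicator (fun _ => q j) z : ℝ) := fun j z => by by_cases h : z ∈ T j <;> simp [h]
  have h1 : ∀ (j : ι) (z : X), (T j).indicator (fun _ => (1 : ℂ)) z =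
      ((T j).indicator (fun _ => (1 : ℝ)) z : ℝ) := fun j z => by by_cases h : z ∈ T j <;> simp [h]
  simp only [hq, h1, ← Complex.ofReal_sum, ← Complex.ofReal_sub, Complex.norm_real, Real.norm_eq_abs,
    sq_abs]
  have hnot : ∀ {i j : ι} {z : X}, z ∈ T i → j ≠ i → z ∉ T j := fun {i j z} hz hij hz' =>
    (Set.disjoint_left.1 (hT hij) hz') hz
  have hsum : ∀ {i : ι} {z : X}, z ∈ T i → ∑ j, (T j).indicator (fun _ => q j) z = q i :=
    fun {i z} hz => by
      rw [Finset.sum_eq_single i (fun j _ hj => by simp [hnot hz hj]) (by simp)]; simp [hz]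
  have hsum0 : ∀ {z : X}, (∀ i, z ∉ T i) → ∑ j, (T j).indicator (fun _ => q j) z = 0 :=
    fun {z} hz => by simp [hz]
  have hle : ∀ s : Finset ι, ∑ j ∈ s, 2 * q j ^ 2 *
      ((T j).indicator (fun _ => (1 : ℝ)) x - (T j).indicator (fun _ => (1 : ℝ)) y) ^ 2 ≤
      ∑ j, 2 * q j ^ 2 *
      ((T j).indicator (fun _ => (1 : ℝ)) x - (T j).indicator (fun _ => (1 : ℝ)) y) ^ 2 := fun s =>
    Finset.sum_le_sum_of_subset_of_nonneg (Finset.subset_univ s) fun _ _ _ => by positivity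
  by_cases hx : ∃ i, x ∈ T i <;> by_cases hy : ∃ i, y ∈ T i
  · obtain ⟨i, hi⟩ := hx
    obtain ⟨k, hk⟩ := hy
    rw [hsum hi, hsum hk]
    by_cases hik : i = k
    · subst hik; simp; positivity
    · refine le_trans ?_ (hle {i, k})
      rw [Finset.sum_pair hik]
      simp only [hi, hk, hnot hi (Ne.symm hik), hnot hk hik, indicator_of_mem,
        indicator_of_notMem, not_false_eq_true]
      nlinarith [sq_nonneg (q i + q k)]
  · obtain ⟨i, hi⟩ := hx
    push Not at hy
    rw [hsum hi, hsum0 hy]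
    refine le_trans ?_ (hle {i})
    simp [hi, hy i]
    nlinarith [sq_nonneg (q i)]
  · obtain ⟨i, hi⟩ := hy
    push Not at hx
    rw [hsum hi, hsum0 hx]
    refine le_trans ?_ (hle {i})
    simp [hi, hx i]
    nlinarith [sq_nonneg (q i)]
  · push Not at hx hy
    rw [hsum0 hx, hsum0 hy]
    simpa using hle ∅

section

variable {V : Type*} [NormedAddCommGroup V] [InnerProductSpace ℝ V] [FiniteDimensional ℝ V]
  [MeasurableSpace V] [BorelSpace V]

/-- If `μ` is dominated by `ν` when tested against all weights `|e(⟪h, ξ⟫) - 1|²`, then it is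
dominated by `ν` when tested against `‖ξ‖ ^ α`, for `0 < α < 2`. -/
theorem lintegral_norm_rpow_le_of_fourierChar {μ ν : Measure V} [SFinite μ] [SFinite ν]
    (H : ∀ h : V, ∫⁻ ξ, ‖(Real.fourierChar (inner ℝ h ξ) : ℂ) - 1‖ₑ ^ 2 ∂μ ≤
      ∫⁻ ξ, ‖(Real.fourierChar (inner ℝ h ξ) : ℂ) - 1‖ₑ ^ 2 ∂ν)
    {α : ℝ} (h0 : 0 < α) (h2 : α < 2) :
    ∫⁻ ξ, ENNReal.ofReal (‖ξ‖ ^ α) ∂μ ≤ ∫⁻ ξ, ENNReal.ofReal (‖ξ‖ ^ α) ∂ν := by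
  obtain ⟨C, hC, hCeq⟩ := exists_lintegral_one_sub_exp_mul_rpow_eq
    (a := 2 * Real.pi ^ 2) (by positivity) h0 h2
  have hmeas : Measurable fun p : (V × ℝ) × V =>
      ENNReal.ofReal (p.1.2 ^ (-1 - α)) *
        ‖(Real.fourierChar (inner ℝ (p.1.2 • p.2) p.1.1) : ℂ) - 1‖ₑ ^ 2 := by
    have : Continuous fun p : (V × ℝ) × V =>
        (Real.fourierChar (inner ℝ (p.1.2 • p.2) p.1.1) : ℂ) := by
      refine continuous_subtype_val.comp (Real.continuous_fourierChar.comp ?_)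
      fun_prop
    have := this.measurable
    fun_prop
  have hrep : ∀ ξ : V, ENNReal.ofReal C * ENNReal.ofReal (‖ξ‖ ^ α) =
      ∫⁻ t in Ioi (0 : ℝ), ∫⁻ h, ENNReal.ofReal (t ^ (-1 - α)) *
        ‖(Real.fourierChar (inner ℝ (t • h) ξ) : ℂ) - 1‖ₑ ^ 2
        ∂(ProbabilityTheory.stdGaussian V) := fun ξ => by
    rw [← hCeq _ (norm_nonneg ξ)]
    refine lintegral_congr fun t => ?_
    rw [lintegral_const_mul' _ _ ENNReal.ofReal_ne_top]
    simp_rw [real_inner_smul_left, ← real_inner_smul_right]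
    rw [lintegral_stdGaussian_enorm_fourierChar_sub_one_sq, norm_smul, Real.norm_eq_abs, mul_pow,
      mul_pow, sq_abs]
  have hswap : ∀ (ρ : Measure V) [SFinite ρ],
      ENNReal.ofReal C * ∫⁻ ξ, ENNReal.ofReal (‖ξ‖ ^ α) ∂ρ =
      ∫⁻ t in Ioi (0 : ℝ), ∫⁻ h, ENNReal.ofReal (t ^ (-1 - α)) *
        ∫⁻ ξ, ‖(Real.fourierChar (inner ℝ (t • h) ξ) : ℂ) - 1‖ₑ ^ 2 ∂ρ
        ∂(ProbabilityTheory.stdGaussian V) := fun ρ _ => by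
    rw [← lintegral_const_mul' _ _ ENNReal.ofReal_ne_top]
    simp_rw [hrep]
    rw [lintegral_lintegral_swap hmeas.lintegral_prod_right'.aemeasurable]
    refine lintegral_congr fun t => ?_
    rw [lintegral_lintegral_swap]
    · simp_rw [lintegral_const_mul' _ _ ENNReal.ofReal_ne_top]
    · exact (hmeas.comp (by fun_prop : Measurable fun p : V × V => ((p.1, t), p.2))).aemeasurable
  have hC0 : ENNReal.ofReal C ≠ 0 := by simpa using hC
  rw [← ENNReal.mul_le_mul_iff_right hC0 ENNReal.ofReal_ne_top, hswap, hswap]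
  exact lintegral_mono fun t => lintegral_mono fun h => mul_le_mul_right (H _) _

/-- A nonnegative combination of the squared moduli of the Fourier transforms of `f j`
dominates the squared modulus of that of `F`, when tested against `(1 + ‖ξ‖ ^ s) ^ 2`, provided
it does so in physical space both for the functions and for their increments. -/
theorem lintegral_sobolev_weight_fourier_sq_le {ι : Type*} [Fintype ι] {F : V → ℂ}
    {f : ι → V → ℂ} {c : ι → ℝ≥0∞} (hF : Integrable F) (hF2 : MemLp F 2)
    (hf : ∀ j, Integrable (f j)) (hf2 : ∀ j, MemLp (f j) 2) (hc : ∀ j, c j ≠ ⊤)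
    (hle : ∀ x, ‖F x‖ₑ ^ 2 ≤ ∑ j, c j * ‖f j x‖ₑ ^ 2)
    (hsub : ∀ x y, ‖F x - F y‖ₑ ^ 2 ≤ ∑ j, c j * ‖f j x - f j y‖ₑ ^ 2)
    {s : ℝ} (hs : 0 < s) (hs1 : s < 1) :
    ∫⁻ ξ, ENNReal.ofReal ((1 + ‖ξ‖ ^ s) ^ 2 * ‖𝓕 F ξ‖ ^ 2) ≤
      ∑ j, c j * ∫⁻ ξ, ENNReal.ofReal ((1 + ‖ξ‖ ^ s) ^ 2 * ‖𝓕 (f j) ξ‖ ^ 2) := by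
  have hcont : ∀ {g : V → ℂ}, Integrable g → Measurable fun ξ => ‖𝓕 g ξ‖ₑ ^ 2 := fun {g} hg =>
    (VectorFourier.fourierIntegral_continuous Real.continuous_fourierChar
      continuous_inner hg : Continuous (𝓕 g)).measurable.enorm.pow_const 2
  have hcontf := fun j => hcont (hf j)
  have hAm := hcont hF
  have hBm : Measurable fun ξ => ∑ j, c j * ‖𝓕 (f j) ξ‖ₑ ^ 2 :=
    Finset.measurable_fun_sum _ fun j _ => (hcontf j).const_mul _
  set μ : Measure V := volume.withDensity fun ξ => ‖𝓕 F ξ‖ₑ ^ 2 with hμ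
  set ν : Measure V := volume.withDensity fun ξ => ∑ j, c j * ‖𝓕 (f j) ξ‖ₑ ^ 2 with hν
  have iμ : ∀ {w : V → ℝ≥0∞}, Measurable w → ∫⁻ ξ, w ξ ∂μ = ∫⁻ ξ, w ξ * ‖𝓕 F ξ‖ₑ ^ 2 :=
    fun {w} hw => by
      rw [hμ, lintegral_withDensity_eq_lintegral_mul _ hAm hw]
      simp [mul_comm]
  have iν : ∀ {w : V → ℝ≥0∞}, Measurable w →
      ∫⁻ ξ, w ξ ∂ν = ∑ j, c j * ∫⁻ ξ, w ξ * ‖𝓕 (f j) ξ‖ₑ ^ 2 :=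
    fun {w} hw => by
      rw [hν, lintegral_withDensity_eq_lintegral_mul _ hBm hw]
      simp only [Pi.mul_apply, Finset.sum_mul]
      have hm : ∀ j ∈ Finset.univ, Measurable fun ξ => c j * ‖𝓕 (f j) ξ‖ₑ ^ 2 * w ξ :=
        fun j _ => ((hcontf j).const_mul (c j)).mul hw
      rw [lintegral_finsetSum _ hm]
      refine Finset.sum_congr rfl fun j _ => ?_
      rw [← lintegral_const_mul' _ _ (hc j)]
      exact lintegral_congr fun ξ => by ring
  have hsum : ∀ g : ι → V → ℂ, (∀ j, MemLp (g j) 2) →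
      ∫⁻ x, ∑ j, c j * ‖g j x‖ₑ ^ 2 = ∑ j, c j * ∫⁻ x, ‖g j x‖ₑ ^ 2 := fun g hg => by
    rw [lintegral_finsetSum' _ fun j _ =>
      ((hg j).aestronglyMeasurable.enorm.pow_const 2).const_mul _]
    exact Finset.sum_congr rfl fun j _ => lintegral_const_mul' _ _ (hc j)
  have hone : ∫⁻ _, 1 ∂μ ≤ ∫⁻ _, 1 ∂ν := by
    rw [iμ measurable_const, iν measurable_const]
    simp only [one_mul]
    rw [lintegral_enorm_fourier_sq hF hF2]
    simp_rw [fun j => lintegral_enorm_fourier_sq (hf j) (hf2 j)]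
    rw [← hsum f hf2]
    exact lintegral_mono hle
  have H : ∀ h : V, ∫⁻ ξ, ‖(Real.fourierChar (inner ℝ h ξ) : ℂ) - 1‖ₑ ^ 2 ∂μ ≤
      ∫⁻ ξ, ‖(Real.fourierChar (inner ℝ h ξ) : ℂ) - 1‖ₑ ^ 2 ∂ν := fun h => by
    have hw : Measurable fun ξ : V => ‖(Real.fourierChar (inner ℝ h ξ) : ℂ) - 1‖ₑ ^ 2 := by
      have : Continuous fun ξ : V => (Real.fourierChar (inner ℝ h ξ) : ℂ) :=
        continuous_subtype_val.comp (Real.continuous_fourierChar.comp (by fun_prop))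
      have := this.measurable
      fun_prop
    rw [iμ hw, iν hw, lintegral_enorm_fourierChar_sub_one_mul_fourier_sq hF hF2]
    simp_rw [fun j => lintegral_enorm_fourierChar_sub_one_mul_fourier_sq (hf j) (hf2 j) h]
    rw [← hsum (fun j x => f j (x + h) - f j x) fun j =>
      ((hf2 j).comp_measurePreserving (measurePreserving_add_right volume h)).sub (hf2 j)]
    exact lintegral_mono fun x => hsub _ _
  have hw : Measurable fun ξ : V => ENNReal.ofReal ((1 + ‖ξ‖ ^ s) ^ 2) := by fun_prop
  have hsplit : ∀ ρ : Measure V, ∫⁻ ξ, ENNReal.ofReal ((1 + ‖ξ‖ ^ s) ^ 2) ∂ρ =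
      ∫⁻ _, 1 ∂ρ + 2 * ∫⁻ ξ, ENNReal.ofReal (‖ξ‖ ^ s) ∂ρ +
        ∫⁻ ξ, ENNReal.ofReal (‖ξ‖ ^ (2 * s)) ∂ρ := fun ρ => by
    rw [← lintegral_const_mul' _ _ (by simp), ← lintegral_add_left (by fun_prop),
      ← lintegral_add_left (by fun_prop)]
    refine lintegral_congr fun ξ => ?_
    have e : ‖ξ‖ ^ (2 * s) = (‖ξ‖ ^ s) ^ 2 := by
      rw [mul_comm, Real.rpow_mul (norm_nonneg _)]; norm_cast
    have hr : 0 ≤ ‖ξ‖ ^ s := by positivity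
    rw [e, ← ENNReal.ofReal_one, ← ENNReal.ofReal_ofNat, ← ENNReal.ofReal_mul (by norm_num),
      ← ENNReal.ofReal_add (by norm_num) (by positivity),
      ← ENNReal.ofReal_add (by positivity) (by positivity)]
    congr 1; ring
  have hmain : ∫⁻ ξ, ENNReal.ofReal ((1 + ‖ξ‖ ^ s) ^ 2) ∂μ ≤
      ∫⁻ ξ, ENNReal.ofReal ((1 + ‖ξ‖ ^ s) ^ 2) ∂ν := by
    rw [hsplit, hsplit]
    exact add_le_add (add_le_add hone (mul_le_mul_right
      (lintegral_norm_rpow_le_of_fourierChar H hs (by linarith)) 2))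
      (lintegral_norm_rpow_le_of_fourierChar H (by linarith) (by linarith))
  rw [iμ hw, iν hw] at hmain
  have e : ∀ (g : V → ℂ) (ξ : V), ENNReal.ofReal ((1 + ‖ξ‖ ^ s) ^ 2 * ‖𝓕 g ξ‖ ^ 2) =
      ENNReal.ofReal ((1 + ‖ξ‖ ^ s) ^ 2) * ‖𝓕 g ξ‖ₑ ^ 2 := fun g ξ => by
    rw [ENNReal.ofReal_mul (by positivity), ENNReal.ofReal_pow (norm_nonneg _), ofReal_norm]
  simpa only [e] using hmain

end

theorem enorm_sum_indicator_sub_sq_le {X ι : Type*} [Fintype ι] {T : ι → Set X}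
    (hT : Pairwise (Function.onFun Disjoint T)) (q : ι → ℝ) (x y : X) :
    ‖(∑ j, (T j).indicator (fun _ => (q j : ℂ)) x) -
        ∑ j, (T j).indicator (fun _ => (q j : ℂ)) y‖ₑ ^ 2 ≤
      ∑ j, ENNReal.ofReal (2 * q j ^ 2) *
        ‖(T j).indicator (fun _ => (1 : ℂ)) x - (T j).indicator (fun _ => (1 : ℂ)) y‖ₑ ^ 2 := by
  have := ENNReal.ofReal_le_ofReal (norm_sum_indicator_sub_sq_le hT q x y)
  rw [ENNReal.ofReal_sum_of_nonneg fun j _ => by positivity] at this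
  simpa only [ENNReal.ofReal_mul (show 0 ≤ 2 * q _ ^ 2 by positivity),
    ENNReal.ofReal_pow (norm_nonneg _), ofReal_norm] using this

theorem enorm_sum_indicator_sq_le {X ι : Type*} [Fintype ι] {T : ι → Set X}
    (hT : Pairwise (Function.onFun Disjoint T)) (q : ι → ℝ) (x : X) :
    ‖∑ j, (T j).indicator (fun _ => (q j : ℂ)) x‖ₑ ^ 2 ≤
      ∑ j, ENNReal.ofReal (2 * q j ^ 2) * ‖(T j).indicator (fun _ => (1 : ℂ)) x‖ₑ ^ 2 := by
  have hdisj : Pairwise (Function.onFun Disjoint fun j => (some '' T j : Set (Option X))) :=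
    fun i j hij => (disjoint_image_iff (Option.some_injective X)).2 (hT hij)
  have hnone : ∀ (j : ι) (a : ℂ), (some '' T j).indicator (fun _ => a) none = 0 :=
    fun j a => indicator_of_notMem (by simp) _
  have hsome : ∀ (j : ι) (a : ℂ), (some '' T j).indicator (fun _ => a) (some x) =
      (T j).indicator (fun _ => a) x := fun j a => by
    by_cases h : x ∈ T j <;> simp [h]
  simpa only [hnone, hsome, Finset.sum_const_zero, sub_zero] using
    enorm_sum_indicator_sub_sq_le hdisj q (some x) none

/-- Let `q = Σ_{j=1}^N q_j χ_{T_j}` be piecewise constant on a bounded domain `Ω ⊂ ℝ³`,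
where the `T_j` are pairwise disjoint measurable sets with `|T_j| ≤ V₀`, surface measure of
the boundary `≤ S₀`, `|q_j| ≤ Q₀`, and each indicator satisfies the standard fractional
Sobolev bound `‖χ_{T_j}‖²_{H^s} ≤ |T_j|^{1-2s}|∂T_j|^{2s} ≤ V₀^{1-2s} S₀^{2s}`. Then for
`s ∈ (0, 1/2)`, `‖q‖²_{H^s(Ω)} ≤ 2 Q₀² N V₀^{1-2s} S₀^{2s}` (the `H^s` norm is
computed via the Fourier transform of the extension of `q` by zero). -/
theorem stmt6 (N : ℕ) (s Q0 V0 S0 : ℝ)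
    (hs : 0 < s) (hs2 : s < 1 / 2) (hQ0 : 0 ≤ Q0) (hV0 : 0 ≤ V0) (hS0 : 0 ≤ S0)
    (Ω : Set (EuclideanSpace ℝ (Fin 3))) (hΩ : Bornology.IsBounded Ω)
    (T : Fin N → Set (EuclideanSpace ℝ (Fin 3)))
    (hTm : ∀ j, MeasurableSet (T j)) (hTsub : ∀ j, T j ⊆ Ω)
    (hdisj : Pairwise (Function.onFun Disjoint T))
    (hvolT : ∀ j, volume (T j) ≤ ENNReal.ofReal V0)
    (hsurfT : ∀ j, μH[2] (frontier (T j)) ≤ ENNReal.ofReal S0)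
    (q : Fin N → ℝ) (hq : ∀ j, |q j| ≤ Q0)
    (hpiece : ∀ j,
      ∫⁻ ξ, ENNReal.ofReal ((1 + ‖ξ‖ ^ s) ^ 2 *
          ‖𝓕 (fun x => (T j).indicator (fun _ => (1 : ℂ)) x) ξ‖ ^ 2) ≤
        ENNReal.ofReal (V0 ^ (1 - 2 * s) * S0 ^ (2 * s))) :
    ∫⁻ ξ, ENNReal.ofReal ((1 + ‖ξ‖ ^ s) ^ 2 *
        ‖𝓕 (fun x => ∑ j, (T j).indicator (fun _ => ((q j : ℝ) : ℂ)) x) ξ‖ ^ 2) ≤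
      ENNReal.ofReal (2 * Q0 ^ 2 * N * (V0 ^ (1 - 2 * s) * S0 ^ (2 * s))) := by
  have hfin : ∀ j, volume (T j) ≠ ⊤ := fun j => ne_top_of_le_ne_top ENNReal.ofReal_ne_top (hvolT j)
  have hLp : ∀ (p : ℝ≥0∞) (a : ℂ) j, MemLp ((T j).indicator fun _ => a) p volume := fun p a j =>
    memLp_indicator_const p (hTm j) a (.inr (hfin j))
  have hL1 : ∀ (a : ℂ) j, Integrable ((T j).indicator fun _ => a) volume := fun a j =>
    memLp_one_iff_integrable.1 (hLp 1 a j)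
  refine (lintegral_sobolev_weight_fourier_sq_le
    (F := fun x => ∑ j, (T j).indicator (fun _ => ((q j : ℝ) : ℂ)) x)
    (f := fun j x => (T j).indicator (fun _ => (1 : ℂ)) x)
    (integrable_finsetSum _ fun j _ => hL1 _ j) (memLp_finsetSum _ fun j _ => hLp 2 _ j)
    (hL1 1) (hLp 2 1) (fun j => ENNReal.ofReal_ne_top) (enorm_sum_indicator_sq_le hdisj q)
    (enorm_sum_indicator_sub_sq_le hdisj q) hs (by linarith)).trans ?_
  calc _ ≤ ∑ _j : Fin N, ENNReal.ofReal (2 * Q0 ^ 2) *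
        ENNReal.ofReal (V0 ^ (1 - 2 * s) * S0 ^ (2 * s)) := by
        refine Finset.sum_le_sum fun j _ => mul_le_mul' (ENNReal.ofReal_le_ofReal ?_) (hpiece j)
        exact mul_le_mul_of_nonneg_left
          (sq_le_sq' (abs_le.1 (hq j)).1 (abs_le.1 (hq j)).2) zero_le_two
    _ = _ := by
        rw [Finset.sum_const, Finset.card_univ, Fintype.card_fin, nsmul_eq_mul,
          ← ENNReal.ofReal_mul (by positivity), ← ENNReal.ofReal_natCast,
          ← ENNReal.ofReal_mul (by positivity)]
        congr 1; ring
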